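/- arXiv:2501.05365 — 9 statements merged into one kernel-verified Lean document; each statement's English description precedes it below -/
import Mathlib

section
/- Let δ ∈ [-1,1] with δ ≠ 0, and let α, σ², m, C > 0. Define f : (0,∞) → ℝ by f(x) = C · x^(α/(σ²δ) − 2 + (1+δ)/2) · exp(−(α/(σ²δ²))·(x/m)^δ). Then for every x > 0 the stationary Fokker–Planck equation holds: (α/δ)·x^((1−δ)/2)·((x/m)^δ − 1)·f(x) + σ² · d/dx ( x^((3−δ)/2) · f(x) ) = 0, i.e. the function x ↦ x^((3−δ)/2) f(x) has at each x > 0 a derivative equal to −(α/(σ²δ))·x^((1−δ)/2)·((x/m)^δ − 1)·f(x). -/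
open Real Set

theorem stmt_0 (δ α σ2 m C : ℝ) (hδ : δ ∈ Set.Icc (-1 : ℝ) 1) (hδ0 : δ ≠ 0)
    (hα : 0 < α) (hσ : 0 < σ2) (hm : 0 < m) (hC : 0 < C)
    (f : ℝ → ℝ)
    (hf : ∀ x, f x = C * x ^ (α / (σ2 * δ) - 2 + (1 + δ) / 2) *
      Real.exp (-(α / (σ2 * δ ^ 2)) * (x / m) ^ δ)) :
    ∀ x : ℝ, 0 < x →
      HasDerivAt (fun y => y ^ ((3 - δ) / 2) * f y)
        (-(α / (σ2 * δ)) * x ^ ((1 - δ) / 2) * ((x / m) ^ δ - 1) * f x) x := by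
  intro x hx
  have hb : α / (σ2 * δ ^ 2) = α / (σ2 * δ) / δ := by
    field_simp
  simp only [hb] at hf
  generalize α / (σ2 * δ) = a at *
  have hxm : 0 < x / m := div_pos hx hm
  have h1 : HasDerivAt (fun y : ℝ => y ^ a) (a * x ^ (a - 1)) x :=
    Real.hasDerivAt_rpow_const (Or.inl hx.ne')
  have h2 : HasDerivAt (fun y : ℝ => (y / m) ^ δ) (1 / m * δ * (x / m) ^ (δ - 1)) x :=
    ((hasDerivAt_id x).div_const m).rpow_const (Or.inl hxm.ne')
  have h3 := (h1.const_mul C).mul ((h2.const_mul (-(a / δ))).exp)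
  have key : HasDerivAt (fun y : ℝ => C * y ^ a * Real.exp (-(a / δ) * (y / m) ^ δ))
      (-a * x ^ ((1 - δ) / 2) * ((x / m) ^ δ - 1) * f x) x := by
    refine h3.congr_deriv ?_
    have e1 : x ^ (a - 2 + (1 + δ) / 2) * x ^ ((1 - δ) / 2) = x ^ a / x := by
      rw [← Real.rpow_add hx, ← Real.rpow_sub_one hx.ne']
      congr 1
      ring
    rw [hf x, Real.rpow_sub_one hxm.ne', Real.rpow_sub_one hx.ne']
    generalize Real.exp (-(a / δ) * (x / m) ^ δ) = E
    trans -a * ((x / m) ^ δ - 1) * C * E *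
      (x ^ (a - 2 + (1 + δ) / 2) * x ^ ((1 - δ) / 2))
    · rw [e1]
      generalize (x / m) ^ δ = u
      field_simp
      ring
    · ring
  refine key.congr_of_eventuallyEq ?_
  filter_upwards [lt_mem_nhds hx] with y hy
  have e2 : y ^ ((3 - δ) / 2) * y ^ (a - 2 + (1 + δ) / 2) = y ^ a := by
    rw [← Real.rpow_add hy]
    congr 1
    ring
  rw [hf y, ← e2]
  ring
end

section
/- Let α, σ², m > 0, C > 0, δ ∈ [−1,1] with δ ≠ 0, and let f(x) = C · x^(α/(σ²δ) − 2 + (1+δ)/2) · exp(−(α/(σ²δ²))·(x/m)^δ) for x > 0. (i) If δ ∈ (0,1], then for every r ≥ 0 the tail moment ∫₁^∞ x^r f(x) dx is finite (slim tails with exponential decay). (ii) If δ ∈ [−1,0), then for every r ≥ 1 − (1+δ)/2 + α/(σ²·(−δ)) the tail moment ∫₁^∞ x^r f(x) dx is infinite (fat tails with polynomial decay). -/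
open Real Set MeasureTheory

theorem stmt_5 (δ α σ2 m C : ℝ) (hδmem : δ ∈ Set.Icc (-1 : ℝ) 1) (hδ0 : δ ≠ 0)
    (hα : 0 < α) (hσ : 0 < σ2) (hm : 0 < m) (hC : 0 < C)
    (f : ℝ → ℝ)
    (hf : ∀ x, f x = C * x ^ (α / (σ2 * δ) - 2 + (1 + δ) / 2) *
      Real.exp (-(α / (σ2 * δ ^ 2)) * (x / m) ^ δ)) :
    (δ ∈ Set.Ioc (0 : ℝ) 1 → ∀ r : ℝ, 0 ≤ r →
      (∫⁻ x in Set.Ioi (1 : ℝ), ENNReal.ofReal (x ^ r * f x)) < ⊤) ∧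
    (δ ∈ Set.Ico (-1 : ℝ) 0 → ∀ r : ℝ, 1 - (1 + δ) / 2 + α / (σ2 * (-δ)) ≤ r →
      (∫⁻ x in Set.Ioi (1 : ℝ), ENNReal.ofReal (x ^ r * f x)) = ⊤) := by
  have hA : 0 < α / (σ2 * δ ^ 2) := by positivity
  set A := α / (σ2 * δ ^ 2) with hAdef
  set p := α / (σ2 * δ) - 2 + (1 + δ) / 2 with hp
  have key : ∀ r x : ℝ, 0 < x → x ^ r * f x = C * (x ^ (r + p) * Real.exp (-A * (x / m) ^ δ)) := by
    intro r x hx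
    rw [hf, Real.rpow_add hx r p]; ring
  constructor
  · rintro ⟨h0, h1⟩ r hr
    have hb : 0 < A * m ^ (-δ) := by positivity
    have hs : (-1 : ℝ) < max (r + p) 0 := lt_of_lt_of_le (by norm_num) (le_max_right _ _)
    have hI := ((integrableOn_rpow_mul_exp_neg_mul_rpow hs h0 hb).mono_set
      (Set.Ioi_subset_Ioi (zero_le_one (α := ℝ)))).const_mul C
    refine lt_of_le_of_lt ?_ hI.lintegral_lt_top
    refine setLIntegral_mono' measurableSet_Ioi fun x hx => ENNReal.ofReal_le_ofReal ?_
    have hx1 : (1 : ℝ) < x := hx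
    have hx0 : 0 < x := by linarith
    rw [key r x hx0]
    have e : -A * (x / m) ^ δ = -(A * m ^ (-δ)) * x ^ δ := by
      rw [Real.div_rpow hx0.le hm.le, Real.rpow_neg hm.le]; ring
    rw [e]
    gcongr
    · exact hx1.le
    · exact le_max_left _ _
  · rintro ⟨h0, h1⟩ r hr
    by_contra hne
    set K := C * Real.exp (-A * (1 / m) ^ δ) with hK
    have hKp : 0 < K := by positivity
    have hs : -1 ≤ r + p := by
      have : α / (σ2 * (-δ)) = -(α / (σ2 * δ)) := by rw [mul_neg, div_neg]
      rw [this] at hr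
      rw [hp]; linarith
    have hle : (∫⁻ x in Set.Ioi (1 : ℝ), ENNReal.ofReal (K * x ^ (r + p))) ≤
        ∫⁻ x in Set.Ioi (1 : ℝ), ENNReal.ofReal (x ^ r * f x) := by
      refine setLIntegral_mono' measurableSet_Ioi fun x hx => ENNReal.ofReal_le_ofReal ?_
      have hx1 : (1 : ℝ) < x := hx
      have hx0 : 0 < x := by linarith
      rw [key r x hx0]
      have h2 : (x / m) ^ δ ≤ (1 / m) ^ δ :=
        Real.rpow_le_rpow_of_nonpos (by positivity) (by gcongr) h1.le
      have h3 : Real.exp (-A * (1 / m) ^ δ) ≤ Real.exp (-A * (x / m) ^ δ) :=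
        Real.exp_le_exp.2 (by nlinarith)
      have h4 : 0 < x ^ (r + p) := Real.rpow_pos_of_pos hx0 _
      calc K * x ^ (r + p) = C * (x ^ (r + p) * Real.exp (-A * (1 / m) ^ δ)) := by rw [hK]; ring
        _ ≤ _ := by gcongr
    have hfin := lt_of_le_of_lt hle (lt_top_iff_ne_top.2 hne)
    have hint : IntegrableOn (fun x : ℝ => K * x ^ (r + p)) (Set.Ioi 1) := by
      refine ⟨by fun_prop, ?_⟩
      rw [hasFiniteIntegral_iff_ofReal]
      · exact hfin
      · filter_upwards [ae_restrict_mem measurableSet_Ioi] with x hx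
        have hx0 : (0 : ℝ) < x := lt_trans one_pos hx
        show (0 : ℝ) ≤ K * x ^ (r + p)
        positivity
    have h5 : IntegrableOn (fun x : ℝ => x ^ (r + p)) (Set.Ioi 1) := by
      have := hint.const_mul K⁻¹
      refine this.congr (Filter.Eventually.of_forall fun x => ?_)
      show K⁻¹ * (K * x ^ (r + p)) = x ^ (r + p)
      field_simp
    have := (integrableOn_Ioi_rpow_iff one_pos).1 h5
    linarith
end

section
/- Let α, σ², ν, m > 0, x_T ∈ ℝ, C > 0, and set λ = α/σ². Define g(x) = C · x^(−λ − 2 − 2/(σ²ν)) · exp( −λm/x − (2/(σ²ν))·(x_T/x) ) for x > 0. Then for every x > 0: [ −(α/2)·(m − x) + (x − x_T)/ν ] · g(x) + (σ²/2) · d/dx ( x² · g(x) ) = 0, i.e. x ↦ x² g(x) has derivative (2/σ²)·[ (α/2)(m − x) − (x − x_T)/ν ]·g(x) at each x > 0. -/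
open Real Set

theorem stmt_9 (α σ2 ν m xT C lam : ℝ) (hα : 0 < α) (hσ : 0 < σ2) (hν : 0 < ν)
    (hm : 0 < m) (hC : 0 < C) (hlam : lam = α / σ2)
    (g : ℝ → ℝ)
    (hg : ∀ x, g x = C * x ^ (-lam - 2 - 2 / (σ2 * ν)) *
      Real.exp (-lam * m / x - 2 / (σ2 * ν) * (xT / x))) :
    ∀ x : ℝ, 0 < x →
      HasDerivAt (fun y => y ^ 2 * g y)
        (2 / σ2 * (α / 2 * (m - x) - (x - xT) / ν) * g x) x := by
  intro x hx
  have hgf : g = fun x => C * x ^ (-lam - 2 - 2 / (σ2 * ν)) *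
      Real.exp (-lam * m / x - 2 / (σ2 * ν) * (xT / x)) := funext hg
  have hx0 : x ≠ 0 := hx.ne'
  have h1 : HasDerivAt (fun y : ℝ => y ^ (-lam - 2 - 2 / (σ2 * ν)))
      ((-lam - 2 - 2 / (σ2 * ν)) * x ^ (-lam - 2 - 2 / (σ2 * ν) - 1)) x :=
    Real.hasDerivAt_rpow_const (Or.inl hx0)
  rw [Real.rpow_sub_one hx0] at h1
  have hi := hasDerivAt_inv hx0
  have h2 : HasDerivAt (fun y : ℝ => -lam * m / y - 2 / (σ2 * ν) * (xT / y))
      (-lam * m * (-(x ^ 2)⁻¹) - 2 / (σ2 * ν) * (xT * (-(x ^ 2)⁻¹))) x := by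
    simp only [div_eq_mul_inv _ x, fun y : ℝ => div_eq_mul_inv (-lam * m) y,
      fun y : ℝ => div_eq_mul_inv xT y]
    exact (hi.const_mul (-lam * m)).sub ((hi.const_mul xT).const_mul _)
  have h3 := (hasDerivAt_pow 2 x).mul ((h1.const_mul C).mul h2.exp)
  rw [hgf]
  refine h3.congr_deriv ?_
  simp only [Pi.mul_apply]
  generalize Real.exp _ = E
  generalize x ^ (-lam - 2 - 2 / (σ2 * ν)) = P
  subst hlam
  have := hσ.ne'
  have := hν.ne'
  field_simp
  ring
end

section
/- Let α, σ², ν, m > 0, x_T ∈ ℝ, C > 0, and set ℓ = (α²/(2σ²ν))·(m² + 2·x_T·m). Define g(x) = C · x^(−2−ℓ) · exp( −(α²/(2σ²ν))·( x²/2 − (2m + x_T)·x + m²·x_T/x ) ) for x > 0. Then for every x > 0: (α²/(4ν))·(m − x)²·(x − x_T)·g(x) + (σ²/2)·d/dx ( x²·g(x) ) = 0, i.e. x ↦ x² g(x) has derivative −(α²/(2σ²ν))·(m − x)²·(x − x_T)·g(x) at each x > 0. -/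
open Real Set

theorem stmt_10 (α σ2 ν m xT C ell : ℝ) (hα : 0 < α) (hσ : 0 < σ2) (hν : 0 < ν)
    (hm : 0 < m) (hC : 0 < C)
    (hell : ell = α ^ 2 / (2 * σ2 * ν) * (m ^ 2 + 2 * xT * m))
    (g : ℝ → ℝ)
    (hg : ∀ x, g x = C * x ^ (-2 - ell) *
      Real.exp (-(α ^ 2 / (2 * σ2 * ν)) *
        (x ^ 2 / 2 - (2 * m + xT) * x + m ^ 2 * xT / x))) :
    ∀ x : ℝ, 0 < x →
      HasDerivAt (fun y => y ^ 2 * g y)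
        (-(α ^ 2 / (2 * σ2 * ν)) * (m - x) ^ 2 * (x - xT) * g x) x := by
  intro x hx
  have hx0 : x ≠ 0 := hx.ne'
  obtain rfl : g = _ := funext hg
  generalize α ^ 2 / (2 * σ2 * ν) = K at *
  have h1 : HasDerivAt (fun y : ℝ => y ^ (-2 - ell)) ((-2 - ell) * x ^ (-2 - ell - 1)) x :=
    Real.hasDerivAt_rpow_const (Or.inl hx0)
  have h2 : HasDerivAt (fun y : ℝ => y ^ 2) (2 * x) x := by
    simpa using hasDerivAt_pow 2 x
  have h3 : HasDerivAt (fun y : ℝ => m ^ 2 * xT / y) (m ^ 2 * xT * (-(x ^ 2)⁻¹)) x := by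
    simpa only [div_eq_mul_inv] using (hasDerivAt_inv hx0).const_mul (m ^ 2 * xT)
  have h4 := ((((h2.div_const 2).sub ((hasDerivAt_id x).const_mul (2 * m + xT))).add
    h3).const_mul (-K)).exp
  have h5 := h2.mul ((h1.const_mul C).mul h4)
  refine h5.congr_deriv ?_
  rw [Real.rpow_sub_one hx0]
  simp only [Pi.mul_apply, Pi.add_apply, Pi.sub_apply, id]
  generalize Real.exp _ = E
  generalize x ^ (-2 - ell) = P
  rw [hell]
  field_simp
  ring
end

section
/- Let α, σ², ν, m, x_T > 0 and set λ = α/σ². Define g(x) = x^(−λ − 2 − 2/(σ²ν)) · exp( −λm/x − (2/(σ²ν))·(x_T/x) ) for x > 0. Then: (i) for every r with 0 ≤ r < λ + 1 + 2/(σ²ν), the integral ∫₀^∞ x^r g(x) dx is finite and positive; (ii) for every r ≥ λ + 1 + 2/(σ²ν), the integral ∫₀^∞ x^r g(x) dx is infinite. In particular, the normalized steady state of control strategy A remains fat-tailed: all moments of order at least λ + 1 + 2/(σ²ν) diverge. -/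
open Real Set MeasureTheory

lemma aux_int (s c : ℝ) (hc : 0 < c) (hs : s < -1) :
    IntegrableOn (fun x : ℝ => x ^ s * Real.exp (-c / x)) (Set.Ioi 0) := by
  have h := integrableOn_rpow_mul_exp_neg_mul_rpow (p := 1) (s := -s - 2) (b := c)
    (by linarith) one_pos hc
  have h2 := (integrableOn_Ioi_comp_rpow_iff
    (fun y : ℝ => y ^ (-s - 2) * Real.exp (-c * y ^ (1 : ℝ))) (p := -1) (by norm_num)).2 h
  refine h2.congr_fun ?_ measurableSet_Ioi
  intro x hx
  have hx : 0 < x := hx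
  simp only [smul_eq_mul, rpow_one, abs_neg, abs_one, one_mul]
  rw [← mul_assoc, ← rpow_mul hx.le, ← rpow_add hx, rpow_neg_one, ← div_eq_mul_inv]
  congr 2
  ring

lemma aux_div (s c : ℝ) (hc : 0 < c) (hs : -1 ≤ s) :
    (∫⁻ x in Set.Ioi (0 : ℝ), ENNReal.ofReal (x ^ s * Real.exp (-c / x))) = ⊤ := by
  by_contra hne
  have hm : Measurable (fun x : ℝ => x ^ s * Real.exp (-c / x)) := by fun_prop
  have hi : IntegrableOn (fun x : ℝ => x ^ s * Real.exp (-c / x)) (Set.Ioi 0) := by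
    refine (lintegral_ofReal_ne_top_iff_integrable hm.aestronglyMeasurable ?_).1 hne
    filter_upwards [ae_restrict_mem measurableSet_Ioi] with x hx
    have hx : 0 < x := hx
    simp only [Pi.zero_apply]
    positivity
  have h1 := (hi.mono_set (Ioi_subset_Ioi zero_le_one)).const_mul (Real.exp c)
  have h2 : IntegrableOn (fun x : ℝ => x ^ s) (Set.Ioi 1) := by
    refine Integrable.mono' h1 (by fun_prop) ?_
    filter_upwards [ae_restrict_mem measurableSet_Ioi] with x hx
    have hx : 1 < x := hx
    have hx0 : 0 < x := by linarith
    have hp : 0 < x ^ s := rpow_pos_of_pos hx0 s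
    rw [Real.norm_of_nonneg hp.le]
    have : c / x ≤ c := div_le_self hc.le hx.le
    have h3 : 1 ≤ Real.exp c * Real.exp (-c / x) := by
      rw [← Real.exp_add]
      apply Real.one_le_exp
      rw [neg_div]; linarith
    nlinarith
  have := (integrableOn_Ioi_rpow_iff one_pos).1 h2
  linarith

theorem stmt_11 (α σ2 ν m xT lam : ℝ) (hα : 0 < α) (hσ : 0 < σ2) (hν : 0 < ν)
    (hm : 0 < m) (hxT : 0 < xT) (hlam : lam = α / σ2)
    (g : ℝ → ℝ)
    (hg : ∀ x, g x = x ^ (-lam - 2 - 2 / (σ2 * ν)) *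
      Real.exp (-lam * m / x - 2 / (σ2 * ν) * (xT / x))) :
    (∀ r : ℝ, 0 ≤ r → r < lam + 1 + 2 / (σ2 * ν) →
      IntegrableOn (fun x => x ^ r * g x) (Set.Ioi (0 : ℝ)) ∧
      0 < ∫ x in Set.Ioi (0 : ℝ), x ^ r * g x) ∧
    (∀ r : ℝ, lam + 1 + 2 / (σ2 * ν) ≤ r →
      (∫⁻ x in Set.Ioi (0 : ℝ), ENNReal.ofReal (x ^ r * g x)) = ⊤) := by
  have hl : 0 < lam := by rw [hlam]; positivity
  have hc : 0 < lam * m + 2 / (σ2 * ν) * xT := by positivity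
  have key : ∀ r : ℝ, EqOn (fun x : ℝ => x ^ (r + (-lam - 2 - 2 / (σ2 * ν))) *
      Real.exp (-(lam * m + 2 / (σ2 * ν) * xT) / x)) (fun x => x ^ r * g x) (Set.Ioi 0) := by
    intro r x hx
    have hx : 0 < x := hx
    simp only [hg]
    rw [rpow_add hx, mul_assoc]
    congr 3
    ring
  refine ⟨fun r _ hr => ?_, fun r hr => ?_⟩
  · have hi : IntegrableOn (fun x => x ^ r * g x) (Set.Ioi (0 : ℝ)) :=
      (aux_int _ _ hc (by linarith)).congr_fun (key r) measurableSet_Ioi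
    refine ⟨hi, ?_⟩
    have hpos : ∀ x ∈ Set.Ioi (0 : ℝ), 0 < x ^ r * g x := by
      intro x hx
      have hx : 0 < x := hx
      rw [hg]
      positivity
    rw [setIntegral_pos_iff_support_of_nonneg_ae _ hi]
    · have : Function.support (fun x => x ^ r * g x) ∩ Set.Ioi 0 = Set.Ioi 0 :=
        inter_eq_right.2 fun x hx => (hpos x hx).ne'
      rw [this]
      simp
    · filter_upwards [ae_restrict_mem measurableSet_Ioi] with x hx
      exact (hpos x hx).le
  · rw [← aux_div (r + (-lam - 2 - 2 / (σ2 * ν))) _ hc (by linarith)]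
    exact setLIntegral_congr_fun measurableSet_Ioi fun x hx => congrArg ENNReal.ofReal (key r hx).symm
end

section
/- Let β₁ ≥ 0, Λ > 0 and T > 0. Suppose ρ_S, m_S, m_I : [0,T] → ℝ are continuous, m_I is differentiable, ρ_S(t) ≥ 0, m_S(t) ≥ 0, m_I(t) ≥ 0 for all t, m_S is nonincreasing, and m_I satisfies m_I′(t) = β₁·ρ_S(t)·m_S(t)·m_I(t)·(Λ·m_S(t) − m_I(t)) for all t ∈ [0,T]. If m_I(0) ≤ Λ·m_S(0), then m_I(t) ≤ Λ·m_S(0) for all t ∈ [0,T]. -/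
open Set

theorem stmt_15 (β1 Λ T : ℝ) (hβ1 : 0 ≤ β1) (hΛ : 0 < Λ) (hT : 0 < T)
    (ρS mS mI : ℝ → ℝ)
    (hρSc : ContinuousOn ρS (Set.Icc (0 : ℝ) T))
    (hmSc : ContinuousOn mS (Set.Icc (0 : ℝ) T))
    (hmIc : ContinuousOn mI (Set.Icc (0 : ℝ) T))
    (hρS : ∀ t ∈ Set.Icc (0 : ℝ) T, 0 ≤ ρS t)
    (hmS : ∀ t ∈ Set.Icc (0 : ℝ) T, 0 ≤ mS t)
    (hmI : ∀ t ∈ Set.Icc (0 : ℝ) T, 0 ≤ mI t)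
    (hmSmono : AntitoneOn mS (Set.Icc (0 : ℝ) T))
    (hode : ∀ t ∈ Set.Icc (0 : ℝ) T,
      HasDerivAt mI (β1 * ρS t * mS t * mI t * (Λ * mS t - mI t)) t)
    (h0 : mI 0 ≤ Λ * mS 0) :
    ∀ t ∈ Set.Icc (0 : ℝ) T, mI t ≤ Λ * mS 0 := by
  have key : ∀ ε : ℝ, 0 < ε → ∀ t ∈ Set.Icc (0 : ℝ) T, mI t ≤ Λ * mS 0 + ε * t := by
    intro ε hε t ht
    refine image_le_of_deriv_right_lt_deriv_boundary (B := fun t => Λ * mS 0 + ε * t)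
      (B' := fun _ => ε) hmIc
      (fun x hx => (hode x (Ico_subset_Icc_self hx)).hasDerivWithinAt) (by simpa using h0)
      (fun x => by simpa using ((hasDerivAt_id x).const_mul ε).const_add (Λ * mS 0)) ?_ ht
    intro x hx hxe
    have hx' := Ico_subset_Icc_self hx
    refine lt_of_le_of_lt ?_ hε
    have h1 : mS x ≤ mS 0 := hmSmono (left_mem_Icc.2 hT.le) hx' hx.1
    have h2 : Λ * mS x ≤ Λ * mS 0 := mul_le_mul_of_nonneg_left h1 hΛ.le
    have h3 : 0 ≤ ε * x := mul_nonneg hε.le hx.1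
    have h4 : 0 ≤ β1 * ρS x * mS x * mI x :=
      mul_nonneg (mul_nonneg (mul_nonneg hβ1 (hρS x hx')) (hmS x hx')) (hmI x hx')
    exact mul_nonpos_of_nonneg_of_nonpos h4 (by linarith)
  intro t ht
  refine le_of_forall_pos_le_add fun δ hδ => ?_
  have h := key (δ / T) (div_pos hδ hT) t ht
  have h5 : δ / T * t ≤ δ / T * T := mul_le_mul_of_nonneg_left ht.2 (div_pos hδ hT).le
  rw [div_mul_cancel₀ _ hT.ne'] at h5
  linarith
end

section
/- Let β₁, γ > 0, Λ > 0, T > 0, and let ρ_S, ρ_I, ρ_R, n_S, n_I, n_R : [0,T] → ℝ be differentiable with ρ_J(t) > 0 for all t and J ∈ {S,I,R}. Define m_J(t) = n_J(t)/ρ_J(t). Assume the mass equations ρ_S′ = −β₁ ρ_S m_S ρ_I m_I, ρ_I′ = β₁ ρ_S m_S ρ_I m_I − γ ρ_I, ρ_R′ = γ ρ_I, and the momentum equations with second-moment closure m_{2,S} = Λ m_S²: n_S′ = −β₁ ρ_S Λ m_S² ρ_I m_I, n_I′ = β₁ ρ_S Λ m_S² ρ_I m_I − γ n_I, n_R′ =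 γ n_I. Then the means satisfy the closed system: m_S′ = −β₁ m_S² ρ_I m_I (Λ − 1), m_I′ = β₁ ρ_S m_S m_I (Λ m_S − m_I), and m_R′ = γ (ρ_I/ρ_R)(m_I − m_R). -/
open Set

theorem stmt_16 (β1 γ Λ T : ℝ) (hβ1 : 0 < β1) (hγ : 0 < γ) (hΛ : 0 < Λ) (hT : 0 < T)
    (ρS ρI ρR nS nI nR : ℝ → ℝ)
    (hρS : ∀ t ∈ Set.Icc (0 : ℝ) T, 0 < ρS t)
    (hρI : ∀ t ∈ Set.Icc (0 : ℝ) T, 0 < ρI t)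
    (hρR : ∀ t ∈ Set.Icc (0 : ℝ) T, 0 < ρR t)
    (mS mI mR : ℝ → ℝ)
    (hmS : ∀ t, mS t = nS t / ρS t)
    (hmI : ∀ t, mI t = nI t / ρI t)
    (hmR : ∀ t, mR t = nR t / ρR t)
    (hρS' : ∀ t ∈ Set.Icc (0 : ℝ) T,
      HasDerivAt ρS (-β1 * ρS t * mS t * ρI t * mI t) t)
    (hρI' : ∀ t ∈ Set.Icc (0 : ℝ) T,
      HasDerivAt ρI (β1 * ρS t * mS t * ρI t * mI t - γ * ρI t) t)
    (hρR' : ∀ t ∈ Set.Icc (0 : ℝ) T, HasDerivAt ρR (γ * ρI t) t)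
    (hnS' : ∀ t ∈ Set.Icc (0 : ℝ) T,
      HasDerivAt nS (-β1 * ρS t * (Λ * mS t ^ 2) * ρI t * mI t) t)
    (hnI' : ∀ t ∈ Set.Icc (0 : ℝ) T,
      HasDerivAt nI (β1 * ρS t * (Λ * mS t ^ 2) * ρI t * mI t - γ * nI t) t)
    (hnR' : ∀ t ∈ Set.Icc (0 : ℝ) T, HasDerivAt nR (γ * nI t) t) :
    ∀ t ∈ Set.Icc (0 : ℝ) T,
      HasDerivAt mS (-β1 * mS t ^ 2 * ρI t * mI t * (Λ - 1)) t ∧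
      HasDerivAt mI (β1 * ρS t * mS t * mI t * (Λ * mS t - mI t)) t ∧
      HasDerivAt mR (γ * (ρI t / ρR t) * (mI t - mR t)) t := by
  intro t ht
  have pS := (hρS t ht).ne'
  have pI := (hρI t ht).ne'
  have pR := (hρR t ht).ne'
  have eS : nS t = mS t * ρS t := by rw [hmS]; field_simp
  have eI : nI t = mI t * ρI t := by rw [hmI]; field_simp
  have eR : nR t = mR t * ρR t := by rw [hmR]; field_simp
  have fS : mS = nS / ρS := funext hmS
  have fI : mI = nI / ρI := funext hmI
  have fR : mR = nR / ρR := funext hmR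
  have dS := (hnS' t ht).div (hρS' t ht) pS
  have dI := (hnI' t ht).div (hρI' t ht) pI
  have dR := (hnR' t ht).div (hρR' t ht) pR
  rw [← fS, eS] at dS
  rw [← fI, eI] at dI
  rw [← fR, eR, eI] at dR
  refine ⟨dS.congr_deriv ?_, dI.congr_deriv ?_, dR.congr_deriv ?_⟩
  · clear * - pS
    field_simp
    ring
  · clear * - pI
    field_simp
    ring
  · clear * - pR
    field_simp
end

section
/- Let β₁, β₂, γ > 0, Λ > 0, Θ > 0, T > 0, and let ρ_S, ρ_I, ρ_R, n_S, n_I, n_R : [0,T] → ℝ be differentiable with ρ_J(t) > 0 for all t and J ∈ {S,I,R}. Define m_J = n_J/ρ_J. Assume the mass equations ρ_S′ = −β₁ ρ_S m_S ρ_I m_I − β₂ ρ_S (Λ m_S²) ρ_I (Λ m_I²), ρ_I′ = β₁ ρ_S m_S ρ_I m_I + β₂ ρ_S (Λ m_S²) ρ_I (Λ m_I²) − γ ρ_I, ρ_R′ = γ ρ_I, and the momentum equations with moment closures m_{2,J} = Λ m_J² and m_{3,S} = Λ Θ m_S³: n_S′ = −β₁ ρ_S (Λ m_S²) ρ_I m_I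 − β₂ ρ_S (Λ Θ m_S³) ρ_I (Λ m_I²), n_I′ = β₁ ρ_S (Λ m_S²) ρ_I m_I + β₂ ρ_S (Λ Θ m_S³) ρ_I (Λ m_I²) − γ n_I, n_R′ = γ n_I. Then the means satisfy: m_S′ = −β₁ (Λ − 1) m_S² ρ_I m_I − β₂ Λ² (Θ − 1) m_S³ ρ_I m_I², m_I′ = β₁ ρ_S m_S m_I (Λ m_S − m_I) + β₂ Λ² ρ_S m_S² m_I² (Θ m_S − m_I), and m_R′ = γ (ρ_I/ρ_R)(m_I − m_R). -/
open Set

theorem quot_aux (m n r : ℝ → ℝ) (n' r' v t : ℝ) (hm : ∀ t, m t = n t / r t)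
    (hr : 0 < r t) (hn' : HasDerivAt n n' t) (hr' : HasDerivAt r r' t)
    (hv : v * r t = n' - m t * r') : HasDerivAt m v t := by
  have e : m = fun t => n t / r t := funext hm
  have h := hn'.fun_div hr' hr.ne'
  rw [← e] at h
  have hne := hr.ne'
  have en : n t = m t * r t := by rw [hm t, div_mul_cancel₀ _ hne]
  have ev : v = (n' * r t - n t * r') / r t ^ 2 := by
    rw [eq_div_iff (pow_ne_zero 2 hne), en]
    linear_combination r t * hv
  rw [ev]
  exact h

theorem stmt_17 (β1 β2 γ Λ Θ T : ℝ) (hβ1 : 0 < β1) (hβ2 : 0 < β2) (hγ : 0 < γ)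
    (hΛ : 0 < Λ) (hΘ : 0 < Θ) (hT : 0 < T)
    (ρS ρI ρR nS nI nR : ℝ → ℝ)
    (hρS : ∀ t ∈ Set.Icc (0 : ℝ) T, 0 < ρS t)
    (hρI : ∀ t ∈ Set.Icc (0 : ℝ) T, 0 < ρI t)
    (hρR : ∀ t ∈ Set.Icc (0 : ℝ) T, 0 < ρR t)
    (mS mI mR : ℝ → ℝ)
    (hmS : ∀ t, mS t = nS t / ρS t)
    (hmI : ∀ t, mI t = nI t / ρI t)
    (hmR : ∀ t, mR t = nR t / ρR t)
    (hρS' : ∀ t ∈ Set.Icc (0 : ℝ) T,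
      HasDerivAt ρS (-β1 * ρS t * mS t * ρI t * mI t
        - β2 * ρS t * (Λ * mS t ^ 2) * ρI t * (Λ * mI t ^ 2)) t)
    (hρI' : ∀ t ∈ Set.Icc (0 : ℝ) T,
      HasDerivAt ρI (β1 * ρS t * mS t * ρI t * mI t
        + β2 * ρS t * (Λ * mS t ^ 2) * ρI t * (Λ * mI t ^ 2) - γ * ρI t) t)
    (hρR' : ∀ t ∈ Set.Icc (0 : ℝ) T, HasDerivAt ρR (γ * ρI t) t)
    (hnS' : ∀ t ∈ Set.Icc (0 : ℝ) T,
      HasDerivAt nS (-β1 * ρS t * (Λ * mS t ^ 2) * ρI t * mI t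
        - β2 * ρS t * (Λ * Θ * mS t ^ 3) * ρI t * (Λ * mI t ^ 2)) t)
    (hnI' : ∀ t ∈ Set.Icc (0 : ℝ) T,
      HasDerivAt nI (β1 * ρS t * (Λ * mS t ^ 2) * ρI t * mI t
        + β2 * ρS t * (Λ * Θ * mS t ^ 3) * ρI t * (Λ * mI t ^ 2) - γ * nI t) t)
    (hnR' : ∀ t ∈ Set.Icc (0 : ℝ) T, HasDerivAt nR (γ * nI t) t) :
    ∀ t ∈ Set.Icc (0 : ℝ) T,
      HasDerivAt mS (-β1 * (Λ - 1) * mS t ^ 2 * ρI t * mI t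
        - β2 * Λ ^ 2 * (Θ - 1) * mS t ^ 3 * ρI t * mI t ^ 2) t ∧
      HasDerivAt mI (β1 * ρS t * mS t * mI t * (Λ * mS t - mI t)
        + β2 * Λ ^ 2 * ρS t * mS t ^ 2 * mI t ^ 2 * (Θ * mS t - mI t)) t ∧
      HasDerivAt mR (γ * (ρI t / ρR t) * (mI t - mR t)) t := by
  intro t ht
  have hS := (hρS t ht).ne'
  have hI := (hρI t ht).ne'
  have hR := (hρR t ht).ne'
  have eI : nI t = mI t * ρI t := by rw [hmI t]; field_simp
  refine ⟨quot_aux mS nS ρS _ _ _ t hmS (hρS t ht) (hnS' t ht) (hρS' t ht) ?_,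
    quot_aux mI nI ρI _ _ _ t hmI (hρI t ht) (hnI' t ht) (hρI' t ht) ?_,
    quot_aux mR nR ρR _ _ _ t hmR (hρR t ht) (hnR' t ht) (hρR' t ht) ?_⟩
  · ring
  · rw [eI]; ring
  · rw [eI]; field_simp
end

section
/- Let β₂ ≥ 0, Θ > 0 and T > 0. Suppose ρ_S, m_S, m_I : [0,T] → ℝ are continuous, m_I is differentiable, ρ_S(t) ≥ 0, m_S(t) ≥ 0, m_I(t) ≥ 0 for all t, m_S is nonincreasing, and m_I satisfies m_I′(t) = β₂ Λ² ρ_S(t) m_S(t)² m_I(t)² (Θ m_S(t) − m_I(t)) for all t ∈ [0,T], where Λ > 0 is a constant. If m_I(0) ≤ Θ·m_S(0), then m_I(t) ≤ Θ·m_S(0) for all t ∈ [0,T]. -/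
open Set

theorem stmt_19 (β2 Θ Λ T : ℝ) (hβ2 : 0 ≤ β2) (hΘ : 0 < Θ) (hΛ : 0 < Λ) (hT : 0 < T)
    (ρS mS mI : ℝ → ℝ)
    (hρSc : ContinuousOn ρS (Set.Icc (0 : ℝ) T))
    (hmSc : ContinuousOn mS (Set.Icc (0 : ℝ) T))
    (hmIc : ContinuousOn mI (Set.Icc (0 : ℝ) T))
    (hρS : ∀ t ∈ Set.Icc (0 : ℝ) T, 0 ≤ ρS t)
    (hmS : ∀ t ∈ Set.Icc (0 : ℝ) T, 0 ≤ mS t)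
    (hmI : ∀ t ∈ Set.Icc (0 : ℝ) T, 0 ≤ mI t)
    (hmSmono : AntitoneOn mS (Set.Icc (0 : ℝ) T))
    (hode : ∀ t ∈ Set.Icc (0 : ℝ) T,
      HasDerivAt mI (β2 * Λ ^ 2 * ρS t * mS t ^ 2 * mI t ^ 2 * (Θ * mS t - mI t)) t)
    (h0 : mI 0 ≤ Θ * mS 0) :
    ∀ t ∈ Set.Icc (0 : ℝ) T, mI t ≤ Θ * mS 0 := by
  intro t ht
  have key : ∀ r : ℝ, 0 < r → mI t ≤ Θ * mS 0 + r * t := by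
    intro r hr
    refine image_le_of_deriv_right_lt_deriv_boundary (B := fun x => Θ * mS 0 + r * x)
      (B' := fun _ => r) hmIc
      (fun x hx => (hode x ⟨hx.1, hx.2.le⟩).hasDerivWithinAt) ?_ ?_ ?_ ht
    · simpa using h0
    · intro x
      simpa using ((hasDerivAt_id x).const_mul r).const_add (Θ * mS 0)
    · intro x hx hE
      have hx' : x ∈ Set.Icc (0 : ℝ) T := ⟨hx.1, hx.2.le⟩
      have h1 : mS x ≤ mS 0 := hmSmono ⟨le_rfl, hT.le⟩ hx' hx.1
      have h2 : Θ * mS x ≤ Θ * mS 0 := mul_le_mul_of_nonneg_left h1 hΘ.le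
      have h3 : 0 ≤ r * x := mul_nonneg hr.le hx.1
      have h4 : Θ * mS x - mI x ≤ 0 := by
        linarith
      have h5 : 0 ≤ β2 * Λ ^ 2 * ρS x * mS x ^ 2 * mI x ^ 2 := by
        have := hρS x hx'
        positivity
      exact lt_of_le_of_lt (mul_nonpos_of_nonneg_of_nonpos h5 h4) hr
  refine le_of_forall_pos_le_add fun ε hε => ?_
  have h := key (ε / T) (div_pos hε hT)
  have h6 : ε / T * t ≤ ε := by
    calc ε / T * t ≤ ε / T * T := mul_le_mul_of_nonneg_left ht.2 (div_pos hε hT).le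
      _ = ε := div_mul_cancel₀ _ hT.ne'
  linarith
end
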